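/- arXiv:2003.10953 — 2 statements merged into one kernel-verified Lean document; each statement's English description precedes it below -/
import Mathlib

section
/- Let p ≠ q be real numbers with max(p,q) ≤ 0. Then for every Lebesgue measurable integrable function f : (0,∞) → (0,∞) such that for every t > 0 the integrals ∫₀^t f(s)^p ds and ∫₀^t f(s)^q ds are finite, one has ∫₀^∞ (∫₀^t f(s)^p ds / ∫₀^t f(s)^q ds)^{1/(p−q)} dt ≤ e ∫₀^∞ f(t) dt. -/
open MeasureTheory Set Real

/-- The tangent-line bound `(q - p) u ≤ e^{qu} - e^{pu}` for `q ≤ p ≤ 0`. -/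
lemma sub_mul_le_exp_sub_exp {p q : ℝ} (hqp : q ≤ p) (hp0 : p ≤ 0) (u : ℝ) :
    (q - p) * u ≤ exp (q * u) - exp (p * u) := by
  have h1 : exp (q * u) = exp (p * u) * exp ((q - p) * u) := by
    rw [← exp_add]; ring_nf
  have h2 : (q - p) * u + 1 ≤ exp ((q - p) * u) := add_one_le_exp _
  have h3 : 0 ≤ (q - p) * u * (exp (p * u) - 1) := by
    rcases le_total 0 u with hu | hu
    · have : exp (p * u) ≤ 1 := exp_le_one_iff.2 (mul_nonpos_of_nonpos_of_nonneg hp0 hu)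
      exact mul_nonneg_of_nonpos_of_nonpos
        (mul_nonpos_of_nonpos_of_nonneg (by linarith) hu) (by linarith)
    · have : 1 ≤ exp (p * u) := one_le_exp (mul_nonneg_of_nonpos_of_nonpos hp0 hu)
      exact mul_nonneg (mul_nonneg_of_nonpos_of_nonpos (by linarith) hu) (by linarith)
  nlinarith [mul_le_mul_of_nonneg_left h2 (exp_pos (p * u)).le]

lemma integrableOn_log_of_rpow {f : ℝ → ℝ} {s : Set ℝ} {q : ℝ} (hq0 : q < 0)
    (hmeas : Measurable f) (hs : MeasurableSet s) (hpos : ∀ x ∈ s, 0 < f x)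
    (hf : IntegrableOn f s) (hq : IntegrableOn (fun x => f x ^ q) s) :
    IntegrableOn (fun x => log (f x)) s := by
  refine Integrable.mono' (hf.add (hq.div_const (-q))) hmeas.log.aestronglyMeasurable ?_
  filter_upwards [ae_restrict_mem hs] with x hx
  have hfx := hpos x hx
  have h1 := log_le_self hfx.le
  have h2 : -log (f x) ≤ f x ^ q / (-q) := by
    have := log_le_self (rpow_pos_of_pos hfx q).le
    rw [log_rpow hfx] at this
    rw [le_div_iff₀ (by linarith)]
    linarith
  have h3 : 0 ≤ f x ^ q / (-q) := div_nonneg (rpow_pos_of_pos hfx q).le (by linarith)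
  simp only [Pi.add_apply, norm_eq_abs]
  exact abs_le.2 ⟨by linarith, by linarith⟩

lemma setIntegral_Ioo_log {t : ℝ} (ht : 0 < t) :
    IntegrableOn log (Ioo 0 t) ∧ ∫ s in Ioo 0 t, log s = t * log t - t := by
  refine ⟨?_, ?_⟩
  · have h : IntervalIntegrable log volume 0 t := intervalIntegral.intervalIntegrable_log'
    exact ((intervalIntegrable_iff_integrableOn_Ioc_of_le ht.le).1 h).mono_set Ioo_subset_Ioc_self
  · rw [← integral_Ioc_eq_integral_Ioo, ← intervalIntegral.integral_of_le ht.le, integral_log]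
    simp

lemma setIntegral_Ioo_pos {g : ℝ → ℝ} {t : ℝ} (ht : 0 < t) (hpos : ∀ s ∈ Ioo 0 t, 0 < g s)
    (hg : IntegrableOn g (Ioo 0 t)) : 0 < ∫ s in Ioo 0 t, g s := by
  rw [← integral_Ioc_eq_integral_Ioo, ← intervalIntegral.integral_of_le ht.le]
  exact intervalIntegral.intervalIntegral_pos_of_pos_on
    ((intervalIntegrable_iff_integrableOn_Ioo_of_le ht.le).2 hg) hpos ht

/-- The Gini mean with nonpositive parameters is at most the geometric mean. -/
lemma gini_le_exp_average_log {f : ℝ → ℝ} {p q t : ℝ} (hqp : q < p) (hp0 : p ≤ 0) (ht : 0 < t)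
    (hpos : ∀ s ∈ Ioo 0 t, 0 < f s)
    (hp : IntegrableOn (fun s => f s ^ p) (Ioo 0 t))
    (hq : IntegrableOn (fun s => f s ^ q) (Ioo 0 t))
    (hlog : IntegrableOn (fun s => log (f s)) (Ioo 0 t)) :
    ((∫ s in Ioo 0 t, f s ^ p) / (∫ s in Ioo 0 t, f s ^ q)) ^ (1 / (p - q))
      ≤ exp ((∫ s in Ioo 0 t, log (f s)) / t) := by
  set L := (∫ s in Ioo 0 t, log (f s)) / t with hL
  have hB : 0 < ∫ s in Ioo 0 t, f s ^ q :=
    setIntegral_Ioo_pos ht (fun s hs => rpow_pos_of_pos (hpos s hs) q) hq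
  have hA : 0 < ∫ s in Ioo 0 t, f s ^ p :=
    setIntegral_Ioo_pos ht (fun s hs => rpow_pos_of_pos (hpos s hs) p) hp
  have hconst : IntegrableOn (fun _ : ℝ => L) (Ioo 0 t) := by simp
  have hmono : ∫ s in Ioo 0 t, (q - p) * (log (f s) - L) ≤
      ∫ s in Ioo 0 t, (exp (-(q * L)) * f s ^ q - exp (-(p * L)) * f s ^ p) := by
    refine setIntegral_mono_on ((hlog.sub hconst).const_mul _)
      ((hq.const_mul _).sub (hp.const_mul _)) measurableSet_Ioo fun s hs => ?_
    have h := sub_mul_le_exp_sub_exp hqp.le hp0 (log (f s) - L)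
    have e : ∀ r : ℝ, exp (r * (log (f s) - L)) = exp (-(r * L)) * f s ^ r := fun r => by
      rw [rpow_def_of_pos (hpos s hs), ← exp_add]; ring_nf
    rwa [e, e] at h
  rw [integral_const_mul, integral_sub hlog hconst,
    integral_sub (hq.const_mul _) (hp.const_mul _), integral_const_mul, integral_const_mul,
    setIntegral_const] at hmono
  have hvol : volume.real (Ioo 0 t) = t := by simp [Measure.real, ht.le]
  have hz : (∫ s in Ioo 0 t, log (f s)) - volume.real (Ioo 0 t) • L = 0 := by
    rw [hvol, hL, smul_eq_mul, mul_div_cancel₀ _ ht.ne', sub_self]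
  rw [hz, mul_zero] at hmono
  have hAB : (∫ s in Ioo 0 t, f s ^ p) / (∫ s in Ioo 0 t, f s ^ q) ≤ exp (L * (p - q)) := by
    rw [div_le_iff₀ hB]
    have e1 : exp (L * (p - q)) = exp (p * L) * exp (-(q * L)) := by rw [← exp_add]; ring_nf
    have e2 : exp (p * L) * exp (-(p * L)) = 1 := by rw [← exp_add]; simp
    rw [e1]
    calc _ = exp (p * L) * (exp (-(p * L)) * ∫ s in Ioo 0 t, f s ^ p) := by
          rw [← mul_assoc, e2, one_mul]
      _ ≤ exp (p * L) * (exp (-(q * L)) * ∫ s in Ioo 0 t, f s ^ q) :=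
          mul_le_mul_of_nonneg_left (by linarith) (exp_pos _).le
      _ = _ := by ring
  calc _ ≤ exp (L * (p - q)) ^ (1 / (p - q)) :=
        rpow_le_rpow (div_pos hA hB).le hAB (one_div_nonneg.2 (by linarith))
    _ = exp L := by
        rw [← exp_mul, mul_assoc, mul_one_div_cancel (by linarith : p - q ≠ 0), mul_one]

/-- The pointwise estimate behind the Pólya–Knopp inequality. -/
lemma exp_average_log_le {f : ℝ → ℝ} {t : ℝ} (ht : 0 < t)
    (hpos : ∀ s ∈ Ioo 0 t, 0 < f s)
    (hsf : IntegrableOn (fun s => s * f s) (Ioo 0 t))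
    (hlog : IntegrableOn (fun s => log (f s)) (Ioo 0 t)) :
    exp ((∫ s in Ioo 0 t, log (f s)) / t) ≤ exp 1 * ((∫ s in Ioo 0 t, s * f s) / t ^ 2) := by
  obtain ⟨hil, hel⟩ := setIntegral_Ioo_log ht
  set J := ∫ s in Ioo 0 t, s * f s with hJ
  have hJ0 : 0 < J := setIntegral_Ioo_pos ht (fun s hs => mul_pos hs.1 (hpos s hs)) hsf
  set c := J / t with hc
  have hc0 : 0 < c := div_pos hJ0 ht
  have hconst : IntegrableOn (fun _ : ℝ => log c - 1) (Ioo 0 t) := by simp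
  have hmono : ∫ s in Ioo 0 t, (log s + log (f s)) ≤
      ∫ s in Ioo 0 t, (s * f s / c + (log c - 1)) := by
    refine setIntegral_mono_on (hil.add hlog) ((hsf.div_const c).add hconst)
      measurableSet_Ioo fun s hs => ?_
    have hm := mul_pos hs.1 (hpos s hs)
    have h := log_le_sub_one_of_pos (div_pos hm hc0)
    rw [log_div hm.ne' hc0.ne', log_mul hs.1.ne' (hpos s hs).ne'] at h
    linarith
  have hvol : volume.real (Ioo 0 t) = t := by simp [Measure.real, ht.le]
  rw [integral_add hil hlog, integral_add (hsf.div_const c) hconst, integral_div,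
    setIntegral_const, hvol, hel, ← hJ, smul_eq_mul] at hmono
  have hJc : J / c = t := by rw [hc]; field_simp
  rw [hJc] at hmono
  have hfin : (∫ s in Ioo 0 t, log (f s)) / t ≤ 1 + log (J / t ^ 2) := by
    have : log (J / t ^ 2) = log c - log t := by
      rw [← log_div hc0.ne' ht.ne', hc, div_div, sq]
    rw [this, div_le_iff₀ ht]
    linarith
  calc _ ≤ exp (1 + log (J / t ^ 2)) := exp_le_exp.2 hfin
    _ = _ := by rw [exp_add, exp_log (by positivity)]

lemma setIntegral_Ioi_indicator_div_sq {s : ℝ} (hs : 0 < s) (a : ℝ) :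
    IntegrableOn (fun t => (Ioi s).indicator (fun t => s * a / t ^ 2) t) (Ioi 0) ∧
      ∫ t in Ioi 0, (Ioi s).indicator (fun t => s * a / t ^ 2) t = a := by
  have e : EqOn (fun t : ℝ => s * a * t ^ (-2 : ℝ)) (fun t => s * a / t ^ 2) (Ioi s) :=
    fun t ht => by
      have : 0 < t := hs.trans ht
      simp only
      rw [rpow_neg this.le, rpow_two, div_eq_mul_inv]
  have hsub : Ioi (0 : ℝ) ∩ Ioi s = Ioi s := inter_eq_right.2 (Ioi_subset_Ioi hs.le)
  constructor
  · refine (IntegrableOn.integrable_indicator ?_ measurableSet_Ioi).integrableOn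
    have h : IntegrableOn (fun t : ℝ => s * a * t ^ (-2 : ℝ)) (Ioi s) :=
      (integrableOn_Ioi_rpow_of_lt (by norm_num) hs).const_mul _
    exact h.congr_fun e measurableSet_Ioi
  · rw [setIntegral_indicator measurableSet_Ioi, hsub, ← setIntegral_congr_fun measurableSet_Ioi e,
      integral_const_mul, integral_Ioi_rpow_of_lt (by norm_num) hs]
    norm_num
    rw [rpow_neg_one]
    field_simp

lemma integral_average_div_sq {f : ℝ → ℝ} (hmeas : Measurable f) (hint : IntegrableOn f (Ioi 0)) :
    IntegrableOn (fun t => (∫ s in Ioo 0 t, s * f s) / t ^ 2) (Ioi 0) ∧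
      ∫ t in Ioi 0, (∫ s in Ioo 0 t, s * f s) / t ^ 2 = ∫ t in Ioi 0, f t := by
  set μ := (volume : Measure ℝ).restrict (Ioi 0)
  set H : ℝ → ℝ → ℝ := fun s t => (Ioi s).indicator (fun t => s * f s / t ^ 2) t with hH
  have hHm : Measurable (Function.uncurry H) := by
    have : Function.uncurry H =
        {z : ℝ × ℝ | z.1 < z.2}.indicator (fun z => z.1 * f z.1 / z.2 ^ 2) := by
      ext ⟨s, t⟩
      simp [hH, indicator]
    rw [this]
    exact Measurable.indicator (by fun_prop) (measurableSet_lt measurable_fst measurable_snd)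
  have hHi : Integrable (Function.uncurry H) (μ.prod μ) := by
    rw [integrable_prod_iff hHm.aestronglyMeasurable]
    constructor
    · filter_upwards [ae_restrict_mem measurableSet_Ioi] with s hs
      exact (setIntegral_Ioi_indicator_div_sq hs (f s)).1
    · refine hint.norm.congr ?_
      filter_upwards [ae_restrict_mem measurableSet_Ioi] with s hs
      rw [← (setIntegral_Ioi_indicator_div_sq hs ‖f s‖).2]
      refine integral_congr_ae (Filter.Eventually.of_forall fun t => ?_)
      have hs' : 0 < s := hs
      simp only [Function.uncurry, hH, norm_indicator_eq_indicator_norm, norm_div, norm_mul,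
        norm_pow, norm_eq_abs, abs_of_pos hs', sq_abs]
  have hinner : ∀ t ∈ Ioi (0 : ℝ), ∫ s, H s t ∂μ = (∫ s in Ioo 0 t, s * f s) / t ^ 2 := by
    intro t _
    have : (fun s => H s t) = (Iio t).indicator (fun s => s * f s / t ^ 2) := by
      ext s
      simp [hH, indicator]
    rw [this, setIntegral_indicator measurableSet_Iio, Ioi_inter_Iio, integral_div]
  constructor
  · exact (integrableOn_congr_fun hinner measurableSet_Ioi).1 hHi.integral_prod_right
  · rw [← setIntegral_congr_fun measurableSet_Ioi hinner, ← integral_integral_swap hHi]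
    exact setIntegral_congr_fun measurableSet_Ioi
      fun s hs => (setIntegral_Ioi_indicator_div_sq hs (f s)).2

lemma gini_le_of_lt {f : ℝ → ℝ} {p q t : ℝ} (hqp : q < p) (hp0 : p ≤ 0) (ht : 0 < t)
    (hmeas : Measurable f) (hpos : ∀ s ∈ Ioo 0 t, 0 < f s) (hf : IntegrableOn f (Ioo 0 t))
    (hp : IntegrableOn (fun s => f s ^ p) (Ioo 0 t))
    (hq : IntegrableOn (fun s => f s ^ q) (Ioo 0 t)) :
    ((∫ s in Ioo 0 t, f s ^ p) / (∫ s in Ioo 0 t, f s ^ q)) ^ (1 / (p - q))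
      ≤ exp 1 * ((∫ s in Ioo 0 t, s * f s) / t ^ 2) := by
  have hlog := integrableOn_log_of_rpow (hqp.trans_le hp0) hmeas measurableSet_Ioo hpos hf hq
  have hsf : IntegrableOn (fun s => s * f s) (Ioo 0 t) := by
    refine Integrable.mono' (hf.norm.const_mul t)
      (measurable_id.mul hmeas).aestronglyMeasurable ?_
    filter_upwards [ae_restrict_mem measurableSet_Ioo] with s hs
    rw [norm_mul, norm_of_nonneg hs.1.le]
    exact mul_le_mul_of_nonneg_right hs.2.le (norm_nonneg _)
  exact (gini_le_exp_average_log hqp hp0 ht hpos hp hq hlog).trans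
    (exp_average_log_le ht hpos hsf hlog)

/-- Integral Hardy inequality with constant `e` for Gini means `G_{p,q}`
with `max(p,q) ≤ 0` and `p ≠ q`. -/
theorem integral_hardy_gini_nonpos (p q : ℝ) (hpq : p ≠ q) (hmax : max p q ≤ 0)
    (f : ℝ → ℝ) (hmeas : Measurable f)
    (hint : IntegrableOn f (Set.Ioi 0))
    (hpos : ∀ t ∈ Set.Ioi (0:ℝ), 0 < f t)
    (hp : ∀ t ∈ Set.Ioi (0:ℝ), IntegrableOn (fun s => f s ^ p) (Set.Ioo 0 t))
    (hq : ∀ t ∈ Set.Ioi (0:ℝ), IntegrableOn (fun s => f s ^ q) (Set.Ioo 0 t)) :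
    ∫ t in Set.Ioi (0:ℝ),
        ((∫ s in Set.Ioo (0:ℝ) t, f s ^ p) / (∫ s in Set.Ioo (0:ℝ) t, f s ^ q)) ^ (1/(p-q))
      ≤ Real.exp 1 * ∫ t in Set.Ioi (0:ℝ), f t := by
  have hnonneg : ∀ (r t : ℝ), 0 < t → 0 ≤ ∫ s in Ioo 0 t, f s ^ r := fun r t _ =>
    setIntegral_nonneg measurableSet_Ioo fun s hs => (rpow_pos_of_pos (hpos s hs.1) r).le
  obtain ⟨hp0, hq0⟩ := max_le_iff.1 hmax
  obtain ⟨hgi, hge⟩ := integral_average_div_sq hmeas hint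
  rw [← hge, ← integral_const_mul]
  refine integral_mono_of_nonneg ?_ (hgi.const_mul _) ?_
  · filter_upwards [ae_restrict_mem measurableSet_Ioi] with t ht
    exact rpow_nonneg (div_nonneg (hnonneg p t ht) (hnonneg q t ht)) _
  · filter_upwards [ae_restrict_mem measurableSet_Ioi] with t ht
    have hpos' : ∀ s ∈ Ioo 0 t, 0 < f s := fun s hs => hpos s hs.1
    have hf : IntegrableOn f (Ioo 0 t) := hint.mono_set Ioo_subset_Ioi_self
    rcases hpq.lt_or_gt with h | h
    · have e : 1 / (p - q) = -(1 / (q - p)) := by rw [← neg_sub, one_div_neg_eq_neg_one_div]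
      rw [e, rpow_neg (div_nonneg (hnonneg p t ht) (hnonneg q t ht)),
        ← inv_rpow (div_nonneg (hnonneg p t ht) (hnonneg q t ht)), inv_div]
      exact gini_le_of_lt h hq0 ht hmeas hpos' hf (hq t ht) (hp t ht)
    · exact gini_le_of_lt h hp0 ht hmeas hpos' hf (hp t ht) (hq t ht)
end

section
/- Let h : (0,∞) → ℝ be strictly increasing and concave with h(1) = 0 and ∫₀¹ h(1/t) dt < +∞, and let c ∈ (0,∞) be the unique number with ∫₀^c h(1/t) dt = 0. Then for every real C < c there exist a Lebesgue integrable function g : (0,∞) → (0,∞) with 0 < ∫₀^∞ g < ∞ and a Lebesgue measurable map t ↦ y_t ∈ (0,∞) such that for every t > 0 the function s ↦ h(g(s)/y_t) is integrable on (0,t) with ∫₀^t h(g(s)/y_t) ds = 0, and ∫₀^∞ y_t dt > C ∫₀^∞ g(s) ds. -/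
open MeasureTheory Set Real

/-- An increasing concave function on `(0,∞)` has a measurable, positive choice of
supergradients. -/
lemma ConcaveOn.exists_measurable_supergradient {h : ℝ → ℝ}
    (hconc : ConcaveOn ℝ (Ioi 0) h) (hmono : StrictMonoOn h (Ioi 0)) :
    ∃ q : ℝ → ℝ, Measurable q ∧ (∀ w, 0 < w → 0 < q w) ∧
      ∀ w, 0 < w → ∀ x, 0 < x → h x ≤ h w + q w * (x - w) := by
  have hsuper : ∀ w, 0 < w → ∀ x, 0 < x →
      h x ≤ h w + -derivWithin (-h) (Ioi w) w * (x - w) := by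
    intro w hw x hx
    have hwi : w ∈ interior (Ioi (0 : ℝ)) := by rwa [interior_Ioi]
    rcases lt_trichotomy x w with hxw | rfl | hwx
    · have h₁ := hconc.neg.slope_le_leftDeriv_of_mem_interior (mem_Ioi.2 hx) hwi hxw
      have h₂ := hconc.neg.leftDeriv_le_rightDeriv_of_mem_interior hwi
      have h₃ := h₁.trans h₂
      rw [slope_def_field, div_le_iff₀ (by linarith)] at h₃
      simp only [Pi.neg_apply] at h₃
      linarith
    · simp
    · have h₁ := hconc.neg.rightDeriv_le_slope_of_mem_interior hwi (mem_Ioi.2 hx) hwx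
      rw [slope_def_field, le_div_iff₀ (by linarith)] at h₁
      simp only [Pi.neg_apply] at h₁
      linarith
  refine ⟨fun w => -derivWithin (-h) (Ioi w) w, (measurable_derivWithin_Ioi _).neg, ?_, hsuper⟩
  intro w hw
  have h₁ := hsuper w hw (w + 1) (by linarith)
  have h₂ := hmono (mem_Ioi.2 hw) (mem_Ioi.2 (by linarith : 0 < w + 1)) (by linarith)
  linarith

/-- The profile equal to `1` on `(-∞,1]`, to `1/s` on `[1,N]` and to `N/s²` on `[N,∞)`. -/
noncomputable def hardyProfile (N s : ℝ) : ℝ := N / (max 1 s * max N s)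

lemma hardyProfile_pos {N : ℝ} (hN : 1 ≤ N) (s : ℝ) : 0 < hardyProfile N s := by
  unfold hardyProfile
  have := le_max_left 1 s
  have := le_max_left N s
  have : 0 < max 1 s := by linarith
  have : 0 < max N s := by linarith
  positivity

lemma continuous_hardyProfile {N : ℝ} (hN : 1 ≤ N) : Continuous (hardyProfile N) := by
  unfold hardyProfile
  refine continuous_const.div (by fun_prop) fun s => ?_
  have := le_max_left 1 s
  have := le_max_left N s
  have : 0 < max 1 s := by linarith
  have : 0 < max N s := by linarith
  positivity

lemma antitone_hardyProfile {N : ℝ} (hN : 1 ≤ N) : Antitone (hardyProfile N) := by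
  intro a b hab
  unfold hardyProfile
  have := le_max_left 1 a
  have := le_max_left N a
  have : 0 < max 1 a := by linarith
  have : 0 < max N a := by linarith
  gcongr

lemma hardyProfile_of_le {N s : ℝ} (hN : 1 ≤ N) (hs : s ≤ N) :
    hardyProfile N s = 1 / max 1 s := by
  have : 0 < max 1 s := lt_max_of_lt_left one_pos
  rw [hardyProfile, max_eq_left hs]
  field_simp

lemma hardyProfile_of_ge {N s : ℝ} (hN : 1 ≤ N) (hs : N ≤ s) :
    hardyProfile N s = N * s ^ (-2 : ℝ) := by
  have : 0 < s := by linarith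
  rw [hardyProfile, max_eq_right hs, max_eq_right (hN.trans hs), rpow_neg this.le, rpow_two]
  field_simp

lemma integrableOn_hardyProfile_Ioi_self {N : ℝ} (hN : 1 ≤ N) :
    IntegrableOn (hardyProfile N) (Ioi N) :=
  IntegrableOn.congr_fun
    ((integrableOn_Ioi_rpow_of_lt (by norm_num) (by linarith)).const_mul N)
    (fun _ hs => (hardyProfile_of_ge hN (mem_Ioi.1 hs).le).symm) measurableSet_Ioi

lemma integrableOn_hardyProfile {N : ℝ} (hN : 1 ≤ N) :
    IntegrableOn (hardyProfile N) (Ioi 0) := by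
  rw [← Ioc_union_Ioi_eq_Ioi (by linarith : (0 : ℝ) ≤ N)]
  exact (((continuous_hardyProfile hN).integrableOn_Icc).mono_set Ioc_subset_Icc_self).union
    (integrableOn_hardyProfile_Ioi_self hN)

lemma integral_hardyProfile {N : ℝ} (hN : 1 ≤ N) :
    ∫ s in Ioi 0, hardyProfile N s = 2 + log N := by
  have hc := continuous_hardyProfile hN
  have h₁ : ∫ s in (0 : ℝ)..1, hardyProfile N s = 1 := by
    rw [intervalIntegral.integral_congr (g := fun _ => (1 : ℝ))]
    · simp
    · intro s hs
      rw [uIcc_of_le zero_le_one] at hs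
      simp [hardyProfile_of_le hN (hs.2.trans hN), max_eq_left hs.2]
  have h₂ : ∫ s in (1 : ℝ)..N, hardyProfile N s = log N := by
    rw [intervalIntegral.integral_congr (g := fun s => 1 / s),
      integral_one_div_of_pos one_pos (by linarith), div_one]
    intro s hs
    rw [uIcc_of_le hN] at hs
    simp [hardyProfile_of_le hN hs.2, max_eq_right hs.1]
  have h₃ : ∫ s in Ioi N, hardyProfile N s = 1 := by
    rw [setIntegral_congr_fun measurableSet_Ioi
      fun s hs => hardyProfile_of_ge hN (mem_Ioi.1 hs).le, integral_const_mul,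
      integral_Ioi_rpow_of_lt (by norm_num) (by linarith)]
    have : N ≠ 0 := by linarith
    norm_num
    rw [rpow_neg_one]
    field_simp
  rw [← intervalIntegral.integral_interval_add_Ioi (b := N) (integrableOn_hardyProfile hN)
    (integrableOn_hardyProfile_Ioi_self hN),
    ← intervalIntegral.integral_add_adjacent_intervals (hc.intervalIntegrable 0 1)
      (hc.intervalIntegrable 1 N), h₁, h₂, h₃]
  ring

section DeviationMean

variable {h g : ℝ → ℝ}

lemma continuous_deviation_comp (hcont : ContinuousOn h (Ioi 0)) (hgc : Continuous g)
    (hgp : ∀ s, 0 < g s) {y : ℝ} (hy : 0 < y) : Continuous fun s => h (g s / y) :=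
  hcont.comp_continuous (hgc.div_const y) fun s => div_pos (hgp s) hy

lemma deviation_integral_lt (hmono : StrictMonoOn h (Ioi 0)) (hcont : ContinuousOn h (Ioi 0))
    (hgc : Continuous g) (hgp : ∀ s, 0 < g s) (hga : Antitone g)
    {t₁ t₂ y₁ y₂ : ℝ} (ht : t₁ ≤ t₂) (hy₁ : 0 < y₁) (hy : y₁ < y₂) :
    ∫ u in (0 : ℝ)..1, h (g (t₂ * u) / y₂) < ∫ u in (0 : ℝ)..1, h (g (t₁ * u) / y₁) := by
  have hi : ∀ t y : ℝ, 0 < y →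
      IntervalIntegrable (fun u => h (g (t * u) / y)) volume 0 1 := fun t y hy =>
    (continuous_deviation_comp hcont (hgc.comp (continuous_const_mul t))
      (fun s => hgp _) hy).intervalIntegrable 0 1
  rw [← sub_pos, ← intervalIntegral.integral_sub (hi _ _ hy₁) (hi _ _ (hy₁.trans hy))]
  refine intervalIntegral.intervalIntegral_pos_of_pos_on
    ((hi _ _ hy₁).sub (hi _ _ (hy₁.trans hy))) (fun u hu => ?_) one_pos
  refine sub_pos.2 (hmono (div_pos (hgp _) (hy₁.trans hy)) (div_pos (hgp _) hy₁) ?_)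
  calc g (t₂ * u) / y₂ < g (t₂ * u) / y₁ := div_lt_div_of_pos_left (hgp _) hy₁ hy
    _ ≤ g (t₁ * u) / y₁ := by
      gcongr
      exact hga (mul_le_mul_of_nonneg_right ht hu.1.le)

lemma exists_deviation_mean (hmono : StrictMonoOn h (Ioi 0)) (hcont : ContinuousOn h (Ioi 0))
    (h1 : h 1 = 0) (hgc : Continuous g) (hgp : ∀ s, 0 < g s) (hga : Antitone g)
    {t : ℝ} (ht : 0 ≤ t) :
    ∃ y, 0 < y ∧ ∫ u in (0 : ℝ)..1, h (g (t * u) / y) = 0 := by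
  have hF : Continuous fun z : ℝ => ∫ u in (0 : ℝ)..1, h (g (t * u) / exp z) := by
    refine intervalIntegral.continuous_parametric_intervalIntegral_of_continuous' ?_ 0 1
    refine hcont.comp_continuous (f := fun p : ℝ × ℝ => g (t * p.2) / exp p.1) ?_
      fun p => div_pos (hgp _) (exp_pos _)
    exact (hgc.comp (by fun_prop)).div (by fun_prop) fun p => (exp_pos _).ne'
  have hlow : 0 ≤ ∫ u in (0 : ℝ)..1, h (g (t * u) / exp (log (g t))) := by
    refine intervalIntegral.integral_nonneg zero_le_one fun u hu => ?_
    rw [exp_log (hgp t), ← h1]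
    refine hmono.monotoneOn (mem_Ioi.2 one_pos) (div_pos (hgp _) (hgp _)) ?_
    rw [one_le_div (hgp t)]
    exact hga (mul_le_of_le_one_right ht hu.2)
  have hup : ∫ u in (0 : ℝ)..1, h (g (t * u) / exp (log (g 0))) ≤ 0 := by
    rw [← neg_nonneg, ← intervalIntegral.integral_neg]
    refine intervalIntegral.integral_nonneg zero_le_one fun u hu => neg_nonneg.2 ?_
    rw [exp_log (hgp 0)]
    refine (hmono.monotoneOn (div_pos (hgp _) (hgp _)) (mem_Ioi.2 one_pos) ?_).trans_eq h1
    rw [div_le_one (hgp 0)]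
    exact hga (mul_nonneg ht hu.1)
  obtain ⟨z, hz⟩ := mem_range_of_exists_le_of_exists_ge hF ⟨_, hup⟩ ⟨_, hlow⟩
  exact ⟨exp z, exp_pos z, hz⟩

lemma deviation_integral_rescale (f : ℝ → ℝ) {t : ℝ} (ht : 0 < t) :
    ∫ s in Ioo 0 t, f s = t * ∫ u in (0 : ℝ)..1, f (t * u) := by
  rw [intervalIntegral.integral_comp_mul_left f ht.ne', mul_zero, mul_one, smul_eq_mul,
    mul_inv_cancel_left₀ ht.ne', intervalIntegral.integral_of_le ht.le,
    integral_Ioc_eq_integral_Ioo]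

lemma intervalIntegrable_reciprocal {c a : ℝ}
    (hcint : IntegrableOn (fun t => h (1 / t)) (Ioo 0 c)) (ha : 0 < a) (hac : a ≤ c) :
    IntervalIntegrable (fun u => h (1 / (a * u))) volume 0 1 := by
  have h₁ : IntervalIntegrable (fun t => h (1 / t)) volume 0 a := by
    rw [intervalIntegrable_iff_integrableOn_Ioo_of_le ha.le]
    exact hcint.mono_set (Ioo_subset_Ioo_right hac)
  simpa [ha.ne'] using h₁.comp_mul_left (c := a)

lemma integral_reciprocal_eq_zero {c : ℝ} (hc : 0 < c)
    (hczero : ∫ t in Ioo (0 : ℝ) c, h (1 / t) = 0) :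
    ∫ u in (0 : ℝ)..1, h (1 / (c * u)) = 0 := by
  rw [deviation_integral_rescale _ hc] at hczero
  exact (mul_eq_zero.1 hczero).resolve_left hc.ne'

/-- The Hardy inequality for deviation means, in qualitative form. -/
lemma integrableOn_deviation_mean (hmono : StrictMonoOn h (Ioi 0))
    (hconc : ConcaveOn ℝ (Ioi 0) h) {c : ℝ} (hc : 0 < c)
    (hcint : IntegrableOn (fun t => h (1 / t)) (Ioo 0 c))
    (hczero : ∫ t in Ioo (0 : ℝ) c, h (1 / t) = 0)
    (hgc : Continuous g) (hgp : ∀ s, 0 < g s)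
    (hgi : IntegrableOn g (Ioi 0)) {y : ℝ → ℝ}
    (hym : AEMeasurable y (volume.restrict (Ioi 0))) (hyp : ∀ t, 0 < t → 0 < y t)
    (hy : ∀ t, 0 < t → ∫ u in (0 : ℝ)..1, h (g (t * u) / y t) = 0) :
    IntegrableOn y (Ioi 0) := by
  have hcont : ContinuousOn h (Ioi 0) := hconc.continuousOn isOpen_Ioi
  obtain ⟨q, hqm, hqp, hq⟩ := hconc.exists_measurable_supergradient hmono
  have hHi := intervalIntegrable_reciprocal hcint hc le_rfl
  have hH0 := integral_reciprocal_eq_zero hc hczero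
  have hw : ∀ u ∈ Ioo (0 : ℝ) 1, 0 < 1 / (c * u) := fun u hu => by
    have := hu.1; positivity
  have hQi : IntervalIntegrable (fun u => q (1 / (c * u)) * (1 / (c * u))) volume 0 1 := by
    rw [intervalIntegrable_iff_integrableOn_Ioo_of_le zero_le_one] at hHi ⊢
    refine Integrable.mono' ((hHi.sub (integrableOn_const
      (C := h (1 / (2 * c))) (by simp))).const_mul 2) (by fun_prop) ?_
    refine (ae_restrict_iff' measurableSet_Ioo).2 (.of_forall fun u hu => ?_)
    have hwu := hw u hu
    have h₁ := hq _ hwu (1 / (c * u) / 2) (by positivity)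
    have h₂ : h (1 / (2 * c)) ≤ h (1 / (c * u) / 2) := by
      refine hmono.monotoneOn (mem_Ioi.2 (by positivity)) (mem_Ioi.2 (by positivity)) ?_
      rw [div_div]
      have := hu.1
      refine one_div_le_one_div_of_le (by positivity) ?_
      nlinarith [hu.2]
    rw [norm_of_nonneg (mul_nonneg (hqp _ hwu).le hwu.le)]
    simp only [Pi.sub_apply]
    linarith
  have hPi : IntervalIntegrable (fun u => q (1 / (c * u))) volume 0 1 := by
    rw [intervalIntegrable_iff_integrableOn_Ioo_of_le zero_le_one] at hQi ⊢
    refine Integrable.mono' (hQi.const_mul c)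
      (hqm.comp (by fun_prop)).aestronglyMeasurable ?_
    refine (ae_restrict_iff' measurableSet_Ioo).2 (.of_forall fun u hu => ?_)
    have := hu.1
    have hqu := hqp _ (hw u hu)
    rw [norm_of_nonneg hqu.le]
    have : c * (q (1 / (c * u)) * (1 / (c * u))) = q (1 / (c * u)) / u := by
      field_simp
    rw [this, le_div_iff₀ hu.1]
    nlinarith [hu.2]
  set D := ∫ u in (0 : ℝ)..1, q (1 / (c * u)) * (1 / (c * u)) with hD
  have hDpos : 0 < D := intervalIntegral.intervalIntegral_pos_of_pos_on hQi
    (fun u hu => mul_pos (hqp _ (hw u hu)) (hw u hu)) one_pos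
  have hPg : ∀ t, 0 < t → IntervalIntegrable
      (fun u => q (1 / (c * u)) * g (t * u)) volume 0 1 := fun t _ =>
    hPi.mul_continuousOn (hgc.comp (continuous_const_mul t)).continuousOn
  have hbound : ∀ t, 0 < t → y t ≤ D⁻¹ * ∫ u in Ioo (0 : ℝ) 1, q (1 / (c * u)) * g (t * u) := by
    intro t ht
    have hyt := hyp t ht
    rw [← integral_Ioc_eq_integral_Ioo, ← intervalIntegral.integral_of_le zero_le_one]
    have hle : ∫ u in (0 : ℝ)..1, h (g (t * u) / y t) ≤ ∫ u in (0 : ℝ)..1,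
        (h (1 / (c * u)) + ((y t)⁻¹ * (q (1 / (c * u)) * g (t * u)) -
          q (1 / (c * u)) * (1 / (c * u)))) := by
      refine intervalIntegral.integral_mono_on_of_le_Ioo zero_le_one
        ((continuous_deviation_comp hcont (hgc.comp (continuous_const_mul t))
          (fun s => hgp _) hyt).intervalIntegrable 0 1)
        (hHi.add (((hPg t ht).const_mul _).sub hQi)) fun u hu => ?_
      have := hq _ (hw u hu) (g (t * u) / y t) (div_pos (hgp _) hyt)
      refine this.trans (le_of_eq ?_)
      ring
    rw [hy t ht, intervalIntegral.integral_add hHi (((hPg t ht).const_mul _).sub hQi), hH0,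
      intervalIntegral.integral_sub ((hPg t ht).const_mul _) hQi,
      intervalIntegral.integral_const_mul, ← hD, zero_add, sub_nonneg,
      le_inv_mul_iff₀ hyt] at hle
    rwa [le_inv_mul_iff₀ hDpos, mul_comm]
  have hprod : Integrable (fun p : ℝ × ℝ => q (1 / (c * p.2)) * g (p.1 * p.2))
      ((volume.restrict (Ioi 0)).prod (volume.restrict (Ioo 0 1))) := by
    rw [integrable_prod_iff']
    · constructor
      · refine (ae_restrict_iff' measurableSet_Ioo).2 (.of_forall fun u hu => ?_)
        refine Integrable.const_mul (f := fun t => g (t * u)) ?_ (q (1 / (c * u)))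
        have := (integrableOn_Ioi_comp_mul_left_iff g 0 hu.1).2 (by simpa using hgi)
        simp only [mul_comm u] at this
        exact this
      · rw [intervalIntegrable_iff_integrableOn_Ioo_of_le zero_le_one] at hQi
        refine IntegrableOn.congr_fun (hQi.const_mul (c * ∫ s in Ioi 0, g s)) (fun u hu => ?_)
          measurableSet_Ioo
        have hu0 := hu.1
        have h₁ : ∀ t, ‖q (1 / (c * u)) * g (t * u)‖ = q (1 / (c * u)) * g (u * t) := fun t => by
          rw [norm_of_nonneg (mul_nonneg (hqp _ (hw u hu)).le (hgp _).le), mul_comm t]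
        simp only [h₁]
        rw [integral_const_mul, integral_comp_mul_left_Ioi g 0 hu0, mul_zero, smul_eq_mul]
        field_simp
    · exact Measurable.aestronglyMeasurable
        ((hqm.comp (by fun_prop)).mul (hgc.measurable.comp (by fun_prop)))
  refine Integrable.mono' (hprod.integral_prod_left.const_mul D⁻¹) hym.aestronglyMeasurable ?_
  refine (ae_restrict_iff' measurableSet_Ioi).2 (.of_forall fun t ht => ?_)
  rw [norm_of_nonneg (hyp t ht).le]
  exact hbound t ht

end DeviationMean

/-- On long stretches where the profile is `1/s`, its deviation means are almost `c/t`. -/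
lemma exists_le_hardyProfile_deviation_mean {h : ℝ → ℝ} (hmono : StrictMonoOn h (Ioi 0))
    (hconc : ConcaveOn ℝ (Ioi 0) h) (h1 : h 1 = 0) {c : ℝ} (hc : 0 < c)
    (hcint : IntegrableOn (fun t => h (1 / t)) (Ioo 0 c))
    (hczero : ∫ t in Ioo (0 : ℝ) c, h (1 / t) = 0) {a : ℝ} (ha : 0 < a) (hac : a < c) :
    ∃ T, 1 ≤ T ∧ ∀ N, ∀ t ∈ Icc T N, ∀ y, 0 < y →
      ∫ u in (0 : ℝ)..1, h (hardyProfile N (t * u) / y) = 0 → a / t ≤ y := by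
  have hcont : ContinuousOn h (Ioi 0) := hconc.continuousOn isOpen_Ioi
  have hci := intervalIntegrable_reciprocal hcint hc le_rfl
  have hai := intervalIntegrable_reciprocal hcint ha hac.le
  have hK : 0 < ∫ u in (0 : ℝ)..1, h (1 / (a * u)) := by
    refine (integral_reciprocal_eq_zero hc hczero).symm.trans_lt ?_
    rw [← sub_pos, ← intervalIntegral.integral_sub hai hci]
    refine intervalIntegral.intervalIntegral_pos_of_pos_on (hai.sub hci) (fun u hu => ?_) one_pos
    have hu0 := hu.1
    refine sub_pos.2 (hmono (mem_Ioi.2 (by positivity)) (mem_Ioi.2 (by positivity)) ?_)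
    gcongr
  have hlim : ∀ᶠ t : ℝ in Filter.atTop, 0 < ∫ u in t⁻¹..1, h (1 / (a * u)) := by
    have hcw := intervalIntegral.continuousOn_primitive_interval_left (a := 0) (b := 1)
      ((intervalIntegrable_iff' (by simp)).1 hai) 0 (by simp)
    have hsub : Filter.Tendsto (fun t : ℝ => t⁻¹) Filter.atTop (nhdsWithin 0 (uIcc 0 1)) := by
      refine tendsto_nhdsWithin_iff.2 ⟨tendsto_inv_atTop_zero, ?_⟩
      filter_upwards [Filter.eventually_ge_atTop 1] with t ht
      rw [uIcc_of_le zero_le_one]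
      exact ⟨by positivity, inv_le_one_of_one_le₀ ht⟩
    exact (hcw.tendsto.comp hsub).eventually (lt_mem_nhds hK)
  obtain ⟨T, hT⟩ := Filter.eventually_atTop.1 hlim
  refine ⟨max (max 1 a) T, by simp, fun N t ht y hy hyz => ?_⟩
  have ht1 : 1 ≤ t := by have := ht.1; simp at this; exact this.1.1
  have hta : a ≤ t := by have := ht.1; simp at this; exact this.1.2
  have htT : T ≤ t := by have := ht.1; simp at this; exact this.2
  have hN : 1 ≤ N := ht1.trans ht.2
  have ht0 : 0 < t := by linarith
  have hat : 0 < a / t := div_pos ha ht0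
  have hδ1 : t⁻¹ ≤ 1 := inv_le_one_of_one_le₀ ht1
  have hδ0 : 0 < t⁻¹ := inv_pos.2 ht0
  by_contra! hlt
  have hneg := deviation_integral_lt hmono hcont (continuous_hardyProfile hN)
    (hardyProfile_pos hN) (antitone_hardyProfile hN) le_rfl hy hlt (t₁ := t)
  rw [hyz] at hneg
  have hcc := continuous_deviation_comp hcont
    ((continuous_hardyProfile hN).comp (continuous_const_mul t))
      (fun s => hardyProfile_pos hN _) hat
  have hsplit := intervalIntegral.integral_add_adjacent_intervals
    (hcc.intervalIntegrable (μ := volume) 0 t⁻¹) (hcc.intervalIntegrable t⁻¹ 1)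
  have hfirst : 0 ≤ ∫ u in (0 : ℝ)..t⁻¹, h (hardyProfile N (t * u) / (a / t)) := by
    refine intervalIntegral.integral_nonneg hδ0.le fun u hu => ?_
    have htu : t * u ≤ 1 := by
      calc t * u ≤ t * t⁻¹ := by gcongr; exact hu.2
        _ = 1 := mul_inv_cancel₀ ht0.ne'
    rw [hardyProfile_of_le hN (htu.trans hN), max_eq_left htu, ← h1]
    refine hmono.monotoneOn (mem_Ioi.2 one_pos) (mem_Ioi.2 (by positivity)) ?_
    rw [div_one, one_div_div]
    exact (one_le_div ha).2 hta
  have hsecond : ∫ u in t⁻¹..1, h (hardyProfile N (t * u) / (a / t)) =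
      ∫ u in t⁻¹..1, h (1 / (a * u)) := by
    refine intervalIntegral.integral_congr fun u hu => ?_
    rw [uIcc_of_le hδ1] at hu
    have hu0 : 0 < u := hδ0.trans_le hu.1
    have htu : 1 ≤ t * u := by
      calc 1 = t * t⁻¹ := (mul_inv_cancel₀ ht0.ne').symm
        _ ≤ t * u := by gcongr; exact hu.1
    have htN : t * u ≤ N := (mul_le_of_le_one_right ht0.le hu.2).trans ht.2
    simp only [hardyProfile_of_le hN htN, max_eq_right htu]
    congr 1
    field_simp
  have := hT t htT
  simp only [Function.comp_apply] at hsplit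
  linarith

/-- Sharpness of the constant `c` in the integral Hardy inequality for the
deviation mean generated by `E(x,y) = h(x/y)`. -/
theorem integral_hardy_deviation_mean_sharp
    (h : ℝ → ℝ) (hmono : StrictMonoOn h (Set.Ioi 0))
    (hconc : ConcaveOn ℝ (Set.Ioi 0) h) (h1 : h 1 = 0)
    (hint : IntegrableOn (fun t => h (1/t)) (Set.Ioo 0 1))
    (c : ℝ) (hc : 0 < c)
    (hcint : IntegrableOn (fun t => h (1/t)) (Set.Ioo 0 c))
    (hczero : ∫ t in Set.Ioo (0:ℝ) c, h (1/t) = 0)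
    (C : ℝ) (hC : C < c) :
    ∃ (g : ℝ → ℝ) (y : ℝ → ℝ),
      IntegrableOn g (Set.Ioi 0) ∧
      (∀ s ∈ Set.Ioi (0:ℝ), 0 < g s) ∧
      (0 < ∫ s in Set.Ioi (0:ℝ), g s) ∧
      AEMeasurable y (volume.restrict (Set.Ioi 0)) ∧
      (∀ t ∈ Set.Ioi (0:ℝ), 0 < y t ∧
        IntegrableOn (fun s => h (g s / y t)) (Set.Ioo 0 t) ∧
        ∫ s in Set.Ioo (0:ℝ) t, h (g s / y t) = 0) ∧
      C * ∫ s in Set.Ioi (0:ℝ), g s < ∫ t in Set.Ioi (0:ℝ), y t := by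
  have hcont : ContinuousOn h (Ioi 0) := hconc.continuousOn isOpen_Ioi
  obtain ⟨a, hCa, hac⟩ := exists_between (max_lt hC hc)
  have ha : 0 < a := (le_max_right _ _).trans_lt hCa
  replace hCa : C < a := (le_max_left _ _).trans_lt hCa
  obtain ⟨T, hT1, hT⟩ :=
    exists_le_hardyProfile_deviation_mean hmono hconc h1 hc hcint hczero ha hac
  obtain ⟨N, hNlog, hTN⟩ := ((tendsto_log_atTop.eventually_gt_atTop
    ((2 * C + a * log T) / (a - C))).and (Filter.eventually_ge_atTop T)).exists
  rw [div_lt_iff₀ (sub_pos.2 hCa)] at hNlog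
  have hN : 1 ≤ N := hT1.trans hTN
  have hgc := continuous_hardyProfile hN
  have hgp := hardyProfile_pos hN
  have hga := antitone_hardyProfile hN
  have hex : ∀ t : ℝ, ∃ y, 0 < t → 0 < y ∧
      ∫ u in (0 : ℝ)..1, h (hardyProfile N (t * u) / y) = 0 := fun t => by
    by_cases ht : 0 < t
    · obtain ⟨y, hy⟩ := exists_deviation_mean hmono hcont h1 hgc hgp hga ht.le
      exact ⟨y, fun _ => hy⟩
    · exact ⟨0, fun h => absurd h ht⟩
  choose y hy using hex
  have hyanti : AntitoneOn y (Ioi 0) := by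
    intro t₁ ht₁ t₂ ht₂ ht
    by_contra! hlt
    have := deviation_integral_lt hmono hcont hgc hgp hga ht (hy t₁ ht₁).1 hlt
    rw [(hy t₁ ht₁).2, (hy t₂ ht₂).2] at this
    exact this.false
  have hym : AEMeasurable y (volume.restrict (Ioi 0)) :=
    aemeasurable_restrict_of_antitoneOn measurableSet_Ioi hyanti
  have hyi : IntegrableOn y (Ioi 0) := integrableOn_deviation_mean hmono hconc hc hcint hczero
    hgc hgp (integrableOn_hardyProfile hN) hym (fun t ht => (hy t ht).1)
    fun t ht => (hy t ht).2
  have hlogN : 0 ≤ log N := log_nonneg hN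
  refine ⟨hardyProfile N, y, integrableOn_hardyProfile hN, fun s _ => hgp s, ?_, hym, ?_, ?_⟩
  · rw [integral_hardyProfile hN]
    linarith
  · intro t ht
    refine ⟨(hy t ht).1, ?_, ?_⟩
    · exact ((continuous_deviation_comp hcont hgc hgp (hy t ht).1).integrableOn_Icc).mono_set
        Ioo_subset_Icc_self
    · rw [deviation_integral_rescale _ ht, (hy t ht).2, mul_zero]
  · have hT0 : 0 < T := by linarith
    have hsub : Ioc T N ⊆ Ioi (0 : ℝ) := fun t ht => hT0.trans ht.1
    have hlower : a * log (N / T) ≤ ∫ t in T..N, y t := by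
      rw [← integral_one_div_of_pos hT0 (by linarith), ← intervalIntegral.integral_const_mul]
      have hone : IntervalIntegrable (fun t : ℝ => 1 / t) volume T N := by
        refine intervalIntegral.intervalIntegrable_one_div (fun t ht => ?_) continuousOn_id
        rw [uIcc_of_le hTN] at ht
        exact (hT0.trans_le ht.1).ne'
      refine intervalIntegral.integral_mono_on hTN (hone.const_mul a)
        ((intervalIntegrable_iff_integrableOn_Ioc_of_le hTN).2 (hyi.mono_set hsub))
        fun t ht => ?_
      have ht0 : 0 < t := hT0.trans_le ht.1
      rw [mul_one_div]
      exact hT N t ht _ (hy t ht0).1 (hy t ht0).2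
    have hupper : ∫ t in T..N, y t ≤ ∫ t in Ioi 0, y t := by
      rw [intervalIntegral.integral_of_le hTN]
      exact setIntegral_mono_set hyi
        ((ae_restrict_iff' measurableSet_Ioi).2 (.of_forall fun t ht => (hy t ht).1.le))
        hsub.eventuallyLE
    rw [log_div (by linarith) hT0.ne'] at hlower
    rw [integral_hardyProfile hN]
    linarith
end
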